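/- Let k ≥ 2 be an integer and let x ∈ A_k^ℕ satisfy δ_{s_k}(x) = p for some finite p ∈ ℕ. Then for every integer n ≥ k and every integer j with 0 ≤ j < |s_k^n(x_0)|, δ_{s_k}(σ^j(s_k^n(x))) = Σ_{l∈A_k} |s_k^n(l)| · |x_{[0…p−1]}|_l + Σ_{l=0}^{n−1} |s_k^l(0)| − j. -/

import Mathlib

/-- The `k`-bonacci substitution on letters: `a ↦ 0(a+1)` if `a ≠ k-1`, and `k-1 ↦ 0`. -/
def sLetter {k : ℕ} (a : Fin k) : List (Fin k) :=
  if h : (a : ℕ) + 1 < k then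
    [⟨0, Nat.lt_of_le_of_lt (Nat.zero_le _) a.isLt⟩, ⟨(a : ℕ) + 1, h⟩]
  else
    [⟨0, Nat.lt_of_le_of_lt (Nat.zero_le _) a.isLt⟩]

/-- Extension of the substitution to finite words by concatenation. -/
def sWord {k : ℕ} (w : List (Fin k)) : List (Fin k) := w.flatMap sLetter

/-- The prefix of length `n` of a right-infinite sequence. -/
def pref {k : ℕ} (x : ℕ → Fin k) (n : ℕ) : List (Fin k) :=
  (List.range n).map x

/-- Extension of the substitution to right-infinite sequences, by concatenating the
images of the letters: since each letter has a nonempty image, the `m`-th letter of the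
image is the `m`-th letter of the image of the prefix of length `m+1`. -/
def sSeq {k : ℕ} (x : ℕ → Fin k) : ℕ → Fin k :=
  fun m => (sWord (pref x (m + 1))).getD m (x 0)

/-- The left shift on sequences. -/
def shift {k : ℕ} (x : ℕ → Fin k) : ℕ → Fin k := fun n => x (n + 1)

/-- The language of the substitution: finite words occurring as a subword of some `s^m(a)`. -/
def Lang {k : ℕ} (w : List (Fin k)) : Prop :=
  ∃ (a : Fin k) (m : ℕ), w <:+: sWord^[m] [a]

/-- `delta x = sup {n : prefix of x of length n is in the language}`, valued in `ℕ∞`. -/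
noncomputable def delta {k : ℕ} (x : ℕ → Fin k) : ℕ∞ :=
  sSup {N : ℕ∞ | ∃ n : ℕ, N = (n : ℕ∞) ∧ Lang (pref x n)}

/-- The subshift associated to the substitution: sequences all of whose subwords
lie in the language. -/
def Attr (k : ℕ) : Set (ℕ → Fin k) :=
  {x | ∀ i n, Lang ((List.range n).map (fun j => x (i + j)))}

/-- The renormalization operator. -/
noncomputable def Renorm {k : ℕ} (V : (ℕ → Fin k) → ℝ) : (ℕ → Fin k) → ℝ :=
  fun x => ∑ j ∈ Finset.range (sLetter (x 0)).length, V (shift^[j] (sSeq x))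

/-- `vcoef k lam l = lam^{-(k-1-l)} * ∑_{j=0}^{k-1-l} lam^j`. -/
noncomputable def vcoef (k : ℕ) (lam : ℝ) (l : ℕ) : ℝ :=
  (∑ j ∈ Finset.range (k - l), lam ^ j) / lam ^ (k - 1 - l)

/-- The fixed point of the renormalization operator. -/
noncomputable def Ufix (k : ℕ) (lam : ℝ) (x : ℕ → Fin k) : ℝ :=
  if delta x = ⊤ then 0
  else Real.log (1 + vcoef k lam (x 0) /
    (lam / (lam - 1)
      + (∑ l : Fin k, vcoef k lam (l : ℕ) * ((pref x (delta x).toNat).count l : ℝ))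
      - vcoef k lam (x 0)))

/-- The word `s^n(0) · s^{n-1}(0) ⋯ s(0) · 0`. -/
def bword {k : ℕ} (z : Fin k) (n : ℕ) : List (Fin k) :=
  ((List.range (n + 1)).map (fun i => sWord^[n - i] [z])).flatten

/-- The word `s^{n-1}(0) · s^{n-2}(0) ⋯ s(0) · 0`. -/
def bsuffix {k : ℕ} (z : Fin k) (n : ℕ) : List (Fin k) :=
  ((List.range n).map (fun i => sWord^[n - 1 - i] [z])).flatten

/-- The letter that follows the leading `0` of `s(a)` in any word `s(a) 0 ⋯`. -/
def nextLetter {k : ℕ} (a : Fin k) : Fin k :=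
  if h : (a : ℕ) + 1 < k then ⟨(a : ℕ) + 1, h⟩
  else ⟨0, Nat.lt_of_le_of_lt (Nat.zero_le _) a.isLt⟩

/-- The words `W₀ = w`, `Wₙ₊₁ = s(Wₙ) 0`. -/
def extWord {k : ℕ} (z : Fin k) (w : List (Fin k)) : ℕ → List (Fin k)
  | 0 => w
  | n + 1 => sWord (extWord z w n) ++ [z]

section Words

variable {k : ℕ}

theorem nextLetter_injective : Function.Injective (nextLetter (k := k)) := by
  intro a b h
  unfold nextLetter at h
  have ha := a.isLt
  have hb := b.isLt
  split_ifs at h <;> simp only [Fin.mk.injEq] at h <;> apply Fin.ext <;> omega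

@[simp] theorem sWord_nil : sWord ([] : List (Fin k)) = [] := rfl

@[simp] theorem sWord_cons (a : Fin k) (w : List (Fin k)) :
    sWord (a :: w) = sLetter a ++ sWord w := rfl

@[simp] theorem sWord_append (u v : List (Fin k)) : sWord (u ++ v) = sWord u ++ sWord v :=
  List.flatMap_append

theorem sWord_iterate_append (n : ℕ) (u v : List (Fin k)) :
    sWord^[n] (u ++ v) = sWord^[n] u ++ sWord^[n] v := by
  induction n generalizing u v with
  | zero => rfl
  | succ n ih => simp [Function.iterate_succ_apply, ih]

theorem sWord_iterate_nil (n : ℕ) : sWord^[n] ([] : List (Fin k)) = [] :=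
  Function.iterate_fixed rfl n

theorem length_sWord_ge (w : List (Fin k)) : w.length ≤ (sWord w).length := by
  induction w with
  | nil => simp
  | cons a w ih =>
    have : 1 ≤ (sLetter a).length := by unfold sLetter; split_ifs <;> simp
    simp only [sWord_cons, List.length_append, List.length_cons]
    omega

theorem sWord_iterate_ne_nil (n : ℕ) {w : List (Fin k)} (hw : w ≠ []) : sWord^[n] w ≠ [] := by
  have : w.length ≤ (sWord^[n] w).length := by
    induction n with
    | zero => rfl
    | succ n ih =>
      rw [Function.iterate_succ_apply']
      exact ih.trans (length_sWord_ge _)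
  rw [← List.length_pos_iff] at hw ⊢
  omega

theorem length_sWord_iterate (n : ℕ) (w : List (Fin k)) :
    (sWord^[n] w).length = ∑ l : Fin k, (sWord^[n] [l]).length * w.count l := by
  induction w with
  | nil => simp [sWord_iterate_nil]
  | cons a w ih =>
    rw [← List.singleton_append, sWord_iterate_append, List.length_append, ih]
    simp [List.count_cons, mul_add, Finset.sum_add_distrib, add_comm]

theorem length_sWord_iterate_extWord (z : Fin k) (w : List (Fin k)) (n m : ℕ) :
    (sWord^[m] (extWord z w n)).length =
      (sWord^[m + n] w).length + ∑ l ∈ Finset.range n, (sWord^[l + m] [z]).length := by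
  induction n generalizing m with
  | zero => simp [extWord]
  | succ n ih =>
    rw [extWord, sWord_iterate_append, List.length_append, ← Function.iterate_succ_apply, ih,
      Finset.sum_range_succ']
    simp only [Nat.succ_eq_add_one, Nat.zero_add, Nat.add_assoc, Nat.add_comm 1]

end Words

section Letters

variable {k : ℕ} {z : Fin k}

theorem sLetter_eq (hz : (z : ℕ) = 0) (a : Fin k) :
    sLetter a = z :: if (a : ℕ) + 1 < k then [nextLetter a] else [] := by
  obtain rfl : z = ⟨0, Nat.lt_of_le_of_lt (Nat.zero_le _) a.isLt⟩ := Fin.ext hz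
  unfold sLetter nextLetter
  split_ifs <;> rfl

theorem nextLetter_ne (hz : (z : ℕ) = 0) {a : Fin k} (h : (a : ℕ) + 1 < k) :
    nextLetter a ≠ z := by
  intro e
  have := congrArg Fin.val e
  simp [nextLetter, h, hz] at this

theorem nextLetter_eq (hz : (z : ℕ) = 0) {a : Fin k} (h : ¬ (a : ℕ) + 1 < k) :
    nextLetter a = z := by
  apply Fin.ext
  simp [nextLetter, h, hz]

theorem exists_sWord_eq_cons (hz : (z : ℕ) = 0) {w : List (Fin k)} (hw : w ≠ []) :
    ∃ R, sWord w = z :: R := by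
  obtain ⟨a, w, rfl⟩ := List.exists_cons_of_ne_nil hw
  exact ⟨_, by rw [sWord_cons, sLetter_eq hz, List.cons_append]⟩

theorem exists_sLetter_append_eq (hz : (z : ℕ) = 0) (a : Fin k) (R : List (Fin k)) :
    ∃ R', sLetter a ++ z :: R = z :: nextLetter a :: R' := by
  rw [sLetter_eq hz]
  split_ifs with h
  · exact ⟨_, rfl⟩
  · exact ⟨R, by simp [nextLetter_eq hz h]⟩

/-- The first letter of a word is determined by the first two letters of its image. -/
theorem eq_of_sWord_cons_eq (hz : (z : ℕ) = 0) {e d : Fin k} {U Q : List (Fin k)}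
    (h : sWord (e :: U) = z :: nextLetter d :: Q) : e = d := by
  apply nextLetter_injective
  rcases eq_or_ne U [] with rfl | hU
  · rw [sWord_cons, sLetter_eq hz] at h
    split_ifs at h <;> simp_all
  · obtain ⟨R, hR⟩ := exists_sWord_eq_cons hz hU
    obtain ⟨R', hR'⟩ := exists_sLetter_append_eq hz e R
    rw [sWord_cons, hR, hR'] at h
    simp_all

theorem prefix_of_sWord_eq (hz : (z : ℕ) = 0) {d : Fin k} {T U Q : List (Fin k)}
    (h : sWord U = sWord T ++ z :: nextLetter d :: Q) : T ++ [d] <+: U := by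
  induction T generalizing U with
  | nil =>
    cases U with
    | nil => simp at h
    | cons e U =>
      rw [eq_of_sWord_cons_eq hz h]
      exact ⟨U, rfl⟩
  | cons t T ih =>
    cases U with
    | nil => simp [sLetter_eq hz] at h
    | cons e U =>
      have hR : ∃ R, sWord T ++ z :: nextLetter d :: Q = z :: R := by
        cases T with
        | nil => exact ⟨_, rfl⟩
        | cons t' T =>
          obtain ⟨R, hR⟩ := exists_sWord_eq_cons hz (List.cons_ne_nil t' T)
          exact ⟨_, by rw [hR, List.cons_append]⟩
      obtain ⟨R, hR⟩ := hR
      obtain ⟨R', hR'⟩ := exists_sLetter_append_eq hz t R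
      have he : e = t := eq_of_sWord_cons_eq hz (Q := R') (by
        rw [h, sWord_cons, List.append_assoc, hR, hR'])
      subst he
      rw [sWord_cons, sWord_cons, List.append_assoc] at h
      exact (List.prefix_cons_inj e).2 (ih (List.append_cancel_left h))

/-- Occurrences of `0` mark the beginnings of images of letters. -/
theorem exists_split_of_sWord_eq (hz : (z : ℕ) = 0) {U P R : List (Fin k)}
    (h : sWord U = P ++ z :: R) : ∃ U₁ U₂, U = U₁ ++ U₂ ∧ sWord U₂ = z :: R := by
  induction U generalizing P with
  | nil => simp at h
  | cons e U ih =>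
    cases P with
    | nil => exact ⟨[], e :: U, rfl, h⟩
    | cons q P =>
      have key : ∃ P', sWord U = P' ++ z :: R := by
        rw [sWord_cons, sLetter_eq hz] at h
        split_ifs at h with hc
        · cases P with
          | nil => simp [nextLetter_ne hz hc] at h
          | cons q' P => exact ⟨P, by simp_all⟩
        · exact ⟨P, by simp_all⟩
      obtain ⟨P', hP'⟩ := key
      obtain ⟨U₁, U₂, rfl, h₂⟩ := ih hP'
      exact ⟨e :: U₁, U₂, rfl, h₂⟩

/-- A nonzero letter in an image is preceded by `0`. -/
theorem exists_prefix_of_sWord_eq (hz : (z : ℕ) = 0) {U P R : List (Fin k)} {c : Fin k}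
    (hc : c ≠ z) (h : sWord U = P ++ c :: R) : ∃ P', P = P' ++ [z] := by
  induction U generalizing P with
  | nil => simp at h
  | cons e U ih =>
    rw [sWord_cons, sLetter_eq hz] at h
    cases P with
    | nil => simp [hc.symm] at h
    | cons q P =>
      split_ifs at h
      · cases P with
        | nil => exact ⟨[], by simp_all⟩
        | cons q' P =>
          obtain ⟨P', rfl⟩ := ih (P := P) (by simp_all)
          exact ⟨q :: q' :: P', rfl⟩
      · obtain ⟨P', rfl⟩ := ih (P := P) (by simp_all)
        exact ⟨q :: P', rfl⟩

theorem Lang.of_infix {u v : List (Fin k)} (h : u <:+: v) (hv : Lang v) : Lang u := by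
  obtain ⟨a, m, hm⟩ := hv
  exact ⟨a, m, h.trans hm⟩

/-- Desubstitution of a word of the language whose first image may be truncated on the left. -/
theorem Lang.desubstitute (hz : (z : ℕ) = 0) {c d : Fin k} {T : List (Fin k)} {j : ℕ}
    (hj : j < (sLetter c).length)
    (h : Lang ((sLetter c).drop j ++ sWord T ++ [z, nextLetter d])) : Lang (c :: T ++ [d]) := by
  obtain ⟨a, m, P, Q, hPQ⟩ := h
  cases m with
  | zero =>
    have := congrArg List.length hPQ
    simp at this
    omega
  | succ m =>
    rw [Function.iterate_succ_apply'] at hPQ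
    have key : ∃ P', sWord (sWord^[m] [a]) =
        P' ++ (sWord (c :: T) ++ z :: nextLetter d :: Q) := by
      rcases j with _ | j
      · exact ⟨P, by simp [← hPQ]⟩
      · rw [sLetter_eq hz] at hj hPQ
        split_ifs at hj hPQ with hc
        · obtain rfl : j = 0 := by simpa using hj
          obtain ⟨P', rfl⟩ := exists_prefix_of_sWord_eq hz (nextLetter_ne hz hc)
            (U := sWord^[m] [a]) (P := P) (R := sWord T ++ z :: nextLetter d :: Q) (by simp [← hPQ])
          exact ⟨P', by simp [← hPQ, sLetter_eq hz, hc]⟩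
        · simp at hj
    obtain ⟨P', hP'⟩ := key
    obtain ⟨R, hR⟩ := exists_sWord_eq_cons hz (List.cons_ne_nil c T)
    obtain ⟨U₁, U₂, hU, h₂⟩ := exists_split_of_sWord_eq hz (P := P')
      (R := R ++ z :: nextLetter d :: Q) (by rw [hP', hR, List.cons_append])
    rw [← List.cons_append, ← hR] at h₂
    refine ⟨a, m, ?_⟩
    rw [hU]
    exact (prefix_of_sWord_eq hz h₂).isInfix.trans (List.suffix_append U₁ U₂).isInfix

theorem exists_sWord_iterate_eq_append_singleton (hz : (z : ℕ) = 0) (m : ℕ) (hm : m < k) :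
    ∃ X, sWord^[m] [z] = X ++ [⟨m, hm⟩] := by
  induction m with
  | zero => exact ⟨[], by simp [Fin.ext_iff, hz]⟩
  | succ m ih =>
    obtain ⟨X, hX⟩ := ih (by omega)
    refine ⟨sWord X ++ [z], ?_⟩
    simp [Function.iterate_succ_apply', hX, sLetter_eq hz, hm, nextLetter]

theorem Lang.sWord_append (hk : 2 ≤ k) (hz : (z : ℕ) = 0) {w : List (Fin k)} (h : Lang w) :
    Lang (sWord w ++ [z]) := by
  obtain ⟨a, m, P, Q, hPQ⟩ := h
  obtain ⟨X, hX⟩ := exists_sWord_iterate_eq_append_singleton hz a a.isLt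
  have h1 : sWord [z] = [z] ++ [nextLetter z] := by
    simp [sLetter_eq hz, show (z : ℕ) + 1 < k by omega]
  obtain ⟨R, hR⟩ := exists_sWord_eq_cons hz (w := Q ++ sWord^[m + a] [nextLetter z])
    (by simp [sWord_iterate_ne_nil])
  refine ⟨z, m + a + 1 + 1, sWord (sWord^[m] X ++ P), R, ?_⟩
  rw [Function.iterate_succ_apply', Function.iterate_succ_apply, h1, sWord_iterate_append,
    Function.iterate_add_apply, hX, sWord_iterate_append, Fin.eta, ← hPQ]
  rw [_root_.sWord_append] at hR
  simp [hR]

end Letters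

section Sequences

variable {k : ℕ} (x : ℕ → Fin k)

@[simp] theorem length_pref (n : ℕ) : (pref x n).length = n := by simp [pref]

theorem pref_succ (n : ℕ) : pref x (n + 1) = pref x n ++ [x n] := by
  simp [pref, List.range_succ]

theorem pref_prefix {m n : ℕ} (h : m ≤ n) : pref x m <+: pref x n := by
  induction n, h using Nat.le_induction with
  | base => exact List.prefix_rfl
  | succ n _ ih => exact ih.trans (by rw [pref_succ]; exact List.prefix_append _ _)

theorem shift_iterate_apply (j i : ℕ) : shift^[j] x i = x (j + i) := by
  induction j generalizing i with
  | zero => simp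
  | succ j ih =>
    rw [Function.iterate_succ_apply', shift, ih]
    congr 1
    omega

theorem pref_shift_iterate (j n : ℕ) : pref (shift^[j] x) n = (pref x (j + n)).drop j := by
  apply List.ext_getElem
  · simp
  · intro i _ _
    simp [pref, shift_iterate_apply]

theorem sWord_prefix {u v : List (Fin k)} (h : u <+: v) : sWord u <+: sWord v := by
  obtain ⟨t, rfl⟩ := h
  rw [sWord_append]
  exact List.prefix_append _ _

theorem sSeq_eq_getElem (m i : ℕ) (hi : i < (sWord (pref x m)).length) :
    sSeq x i = (sWord (pref x m))[i] := by
  have hi' : i < (sWord (pref x (i + 1))).length := by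
    have := length_sWord_ge (pref x (i + 1))
    rw [length_pref] at this
    omega
  rw [sSeq, List.getD_eq_getElem _ _ hi']
  rcases le_total m (i + 1) with h | h
  · exact ((sWord_prefix (pref_prefix x h)).getElem hi).symm
  · exact (sWord_prefix (pref_prefix x h)).getElem hi'

theorem pref_sSeq_of_prefix {u : List (Fin k)} (m : ℕ) (h : u <+: sWord (pref x m)) :
    pref (sSeq x) u.length = u := by
  apply List.ext_getElem
  · simp
  · intro i _ hi
    rw [h.getElem hi, ← sSeq_eq_getElem]
    simp [pref]

theorem pref_sSeq_length_add_two {z : Fin k} (hz : (z : ℕ) = 0) (m : ℕ) :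
    pref (sSeq x) ((sWord (pref x m)).length + 1 + 1) =
      sWord (pref x m) ++ [z] ++ [nextLetter (x m)] := by
  have := pref_sSeq_of_prefix x (u := sWord (pref x m) ++ [z] ++ [nextLetter (x m)]) (m + 2) ?_
  · simpa using this
  · obtain ⟨R, hR⟩ := exists_sWord_eq_cons hz (List.cons_ne_nil (x (m + 1)) [])
    obtain ⟨R', hR'⟩ := exists_sLetter_append_eq hz (x m) R
    refine ⟨R', ?_⟩
    rw [pref_succ, pref_succ, sWord_append, sWord_append, hR, sWord_cons, sWord_nil,
      List.append_nil, List.append_assoc _ (sLetter _), hR']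
    simp

theorem delta_eq_coe_iff (p : ℕ) :
    delta x = (p : ℕ∞) ↔ Lang (pref x p) ∧ ¬ Lang (pref x (p + 1)) := by
  constructor
  · intro h
    refine ⟨?_, fun hL => ?_⟩
    · by_contra hL
      cases p with
      | zero => exact hL ⟨x 0, 0, List.nil_infix⟩
      | succ q =>
        have : delta x ≤ (q : ℕ∞) := by
          apply sSup_le
          rintro _ ⟨n, rfl, hn⟩
          by_contra hlt
          rw [Nat.cast_le] at hlt
          exact hL (hn.of_infix (pref_prefix x (by omega)).isInfix)
        rw [h, Nat.cast_le] at this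
        omega
    · have : ((p + 1 : ℕ) : ℕ∞) ≤ delta x := le_sSup ⟨p + 1, rfl, hL⟩
      rw [h, Nat.cast_le] at this
      omega
  · rintro ⟨h, h'⟩
    apply le_antisymm
    · apply sSup_le
      rintro _ ⟨n, rfl, hn⟩
      by_contra hlt
      rw [Nat.cast_le] at hlt
      exact h' (hn.of_infix (pref_prefix x (by omega)).isInfix)
    · exact le_sSup ⟨p, rfl, h⟩

/-- A position in `s(V)` lies in the image of a unique letter of `V`. -/
theorem exists_letter_of_lt_length_sWord {V : List (Fin k)} {j : ℕ}
    (hj : j < (sWord V).length) :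
    ∃ V₁ c V₂ i, V = V₁ ++ c :: V₂ ∧ j = (sWord V₁).length + i ∧ i < (sLetter c).length := by
  induction V generalizing j with
  | nil => simp at hj
  | cons a V ih =>
    by_cases h : j < (sLetter a).length
    · exact ⟨[], a, V, j, rfl, by simp, h⟩
    · obtain ⟨V₁, c, V₂, i, rfl, h₁, h₂⟩ := ih (j := j - (sLetter a).length) (by
        rw [sWord_cons, List.length_append] at hj
        omega)
      refine ⟨a :: V₁, c, V₂, i, rfl, ?_, h₂⟩
      rw [sWord_cons, List.length_append]
      omega

theorem pref_sSeq_iterate_length {z : Fin k} (hz : (z : ℕ) = 0) (p n : ℕ) :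
    pref (sSeq^[n] x) (extWord z (pref x p) n).length = extWord z (pref x p) n := by
  induction n with
  | zero => simp [extWord]
  | succ n ih =>
    have h := pref_sSeq_length_add_two (sSeq^[n] x) hz (extWord z (pref x p) n).length
    rw [ih, pref_succ] at h
    rw [Function.iterate_succ_apply', extWord, List.length_append]
    exact (List.append_inj h (by simp)).1

theorem sWord_iterate_prefix_extWord {z : Fin k} {w : List (Fin k)} {a : Fin k}
    (h : [a] <+: w) (n : ℕ) : sWord^[n] [a] <+: extWord z w n := by
  induction n with
  | zero => exact h
  | succ n ih =>
    rw [Function.iterate_succ_apply']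
    exact (sWord_prefix ih).trans (List.prefix_append _ _)

theorem lang_extWord (hk : 2 ≤ k) {z : Fin k} (hz : (z : ℕ) = 0) {w : List (Fin k)}
    (h : Lang w) (n : ℕ) : Lang (extWord z w n) := by
  induction n with
  | zero => exact h
  | succ n ih => exact ih.sWord_append hk hz

theorem not_lang_drop_extWord {z : Fin k} (hz : (z : ℕ) = 0) {p : ℕ} (hp : 0 < p)
    (h : ¬ Lang (pref x (p + 1))) (n j : ℕ) (hj : j < (sWord^[n] [x 0]).length) :
    ¬ Lang ((pref (sSeq^[n] x) ((extWord z (pref x p) n).length + 1)).drop j) := by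
  induction n generalizing j with
  | zero =>
    obtain rfl : j = 0 := by simpa using hj
    simpa [extWord] using h
  | succ n ih =>
    set y := sSeq^[n] x with hy
    set W := extWord z (pref x p) n with hW
    have hyW : pref y W.length = W := pref_sSeq_iterate_length x hz p n
    rw [Function.iterate_succ_apply'] at hj
    obtain ⟨V₁, c, V₂, i, hV, rfl, hi⟩ := exists_letter_of_lt_length_sWord hj
    have hpre : sWord^[n] [x 0] <+: W := sWord_iterate_prefix_extWord (pref_prefix x hp) n
    obtain ⟨t, ht⟩ := hpre
    have hWd : W = V₁ ++ c :: (V₂ ++ t) := by rw [← ht, hV]; simp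
    have h' := ih V₁.length (by rw [hV]; simp)
    rw [pref_succ, hyW] at h'
    intro hL
    apply h'
    have h2 := pref_sSeq_length_add_two y hz W.length
    rw [hyW] at h2
    rw [Function.iterate_succ_apply', ← hy, extWord, ← hW, List.length_append,
      List.length_singleton, h2] at hL
    have h3 := Lang.desubstitute hz hi (T := V₂ ++ t) (d := y W.length) (by
      convert hL using 1
      rw [hWd, sWord_append V₁, List.append_assoc (sWord V₁), List.append_assoc (sWord V₁),
        List.drop_length_add_append, sWord_cons, List.append_assoc (sLetter c),
        List.append_assoc (sLetter c), List.drop_append_of_le_length hi.le]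
      simp)
    convert h3 using 1
    rw [hWd, List.append_assoc, List.drop_left]

end Sequences

theorem stmt5 (k : ℕ) (hk : 2 ≤ k) (z0 : Fin k) (hz : (z0 : ℕ) = 0)
    (x : ℕ → Fin k) (p : ℕ) (hp : delta x = (p : ℕ∞)) (n : ℕ) (hn : k ≤ n)
    (j : ℕ) (hj : j < (sWord^[n] [x 0]).length) :
    delta (shift^[j] (sSeq^[n] x)) =
      ((∑ l : Fin k, (sWord^[n] [l]).length * (pref x p).count l
          + (∑ l ∈ Finset.range n, (sWord^[l] [z0]).length) - j : ℕ) : ℕ∞) := by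
  obtain ⟨hL, hL'⟩ := (delta_eq_coe_iff x p).1 hp
  have hp0 : 0 < p := by
    rcases Nat.eq_zero_or_pos p with rfl | h
    · exact absurd ⟨x 0, 0, List.infix_rfl⟩ hL'
    · exact h
  have hlen := length_sWord_iterate_extWord z0 (pref x p) n 0
  simp only [Function.iterate_zero, id, Nat.zero_add, Nat.add_zero] at hlen
  have hle : (sWord^[n] [x 0]).length ≤ (extWord z0 (pref x p) n).length :=
    (sWord_iterate_prefix_extWord (pref_prefix x hp0) n).length_le
  rw [← length_sWord_iterate, ← hlen, delta_eq_coe_iff, pref_shift_iterate, pref_shift_iterate]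
  refine ⟨?_, ?_⟩
  · rw [Nat.add_sub_cancel' (by omega), pref_sSeq_iterate_length x hz]
    exact (lang_extWord hk hz hL n).of_infix (List.drop_suffix _ _).isInfix
  · rw [← Nat.add_assoc, Nat.add_sub_cancel' (by omega)]
    exact not_lang_drop_extWord x hz hp0 hL' n j hj
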